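/- For all integers a ≥ 2 and b ≥ 2 with n = a + 2b − 1, there is no smooth Fano n-polytope Q with n + 2 vertices such that V(Q) ⊆ V(P(a,b)). -/

import Mathlib

/-! ## Basic definitions: lattice polytopes, smooth Fano polytopes,
unimodular equivalence, F- and I-equivalence, primitive collections. -/

/-- A point of `ℝ^n` all of whose coordinates are integers. -/
def IsLatticePoint {n : ℕ} (x : Fin n → ℝ) : Prop := ∀ i, ∃ m : ℤ, x i = (m : ℝ)

/-- The vertex set of a polytope: its extreme points. -/
def vertexSet {n : ℕ} (P : Set (Fin n → ℝ)) : Set (Fin n → ℝ) :=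
  Set.extremePoints ℝ P

/-- A lattice `n`-polytope: the convex hull of finitely many lattice points,
of full dimension `n`. -/
def IsLatticePolytope {n : ℕ} (P : Set (Fin n → ℝ)) : Prop :=
  (∃ S : Finset (Fin n → ℝ), (∀ x ∈ S, IsLatticePoint x) ∧
    P = convexHull ℝ (S : Set (Fin n → ℝ))) ∧
  affineSpan ℝ P = ⊤

/-- A face of `P`: an exposed subset of `P`. -/
def IsFaceOf {n : ℕ} (F P : Set (Fin n → ℝ)) : Prop := IsExposed ℝ P F

/-- A facet of `P`: a face of affine dimension `n - 1`. -/
def IsFacetOf {n : ℕ} (F P : Set (Fin n → ℝ)) : Prop :=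
  IsFaceOf F P ∧ Module.finrank ℝ (vectorSpan ℝ F) + 1 = n

/-- A set `S` of points of `ℝ^n` forms a `ℤ`-basis of `ℤ^n`:
it consists of `n` lattice points whose matrix has determinant `±1`. -/
def IsUnimodularBasis {n : ℕ} (S : Set (Fin n → ℝ)) : Prop :=
  ∃ b : Fin n → (Fin n → ℝ), Function.Injective b ∧ Set.range b = S ∧
    (∀ i, IsLatticePoint (b i)) ∧ |(Matrix.of b).det| = 1

/-- A smooth Fano `n`-polytope: a lattice `n`-polytope with the origin in its
interior such that the vertex set of every facet is a `ℤ`-basis of `ℤ^n`. -/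
def IsSmoothFano {n : ℕ} (P : Set (Fin n → ℝ)) : Prop :=
  IsLatticePolytope P ∧ (0 : Fin n → ℝ) ∈ interior P ∧
    ∀ F : Set (Fin n → ℝ), IsFacetOf F P → IsUnimodularBasis (vertexSet P ∩ F)

/-- Two subsets of `ℝ^n` are unimodularly equivalent if an affine map of `ℝ^n`
mapping `ℤ^n` onto `ℤ^n` maps one onto the other. -/
def UnimodularEquiv {n : ℕ} (Q Q' : Set (Fin n → ℝ)) : Prop :=
  ∃ φ : (Fin n → ℝ) →ᵃ[ℝ] (Fin n → ℝ),
    φ '' {x | IsLatticePoint x} = {x | IsLatticePoint x} ∧ φ '' Q = Q'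

/-- One step of an I-sequence: the vertex set of one polytope is obtained from
the vertex set of the other by adding one new lattice point. -/
def IStep {n : ℕ} (P Q : Set (Fin n → ℝ)) : Prop :=
  (∃ w : Fin n → ℝ, IsLatticePoint w ∧ w ∉ vertexSet P ∧
    vertexSet Q = vertexSet P ∪ {w}) ∨
  (∃ w : Fin n → ℝ, IsLatticePoint w ∧ w ∉ vertexSet Q ∧
    vertexSet P = vertexSet Q ∪ {w})

/-- I-equivalence of smooth Fano `n`-polytopes. -/
def IEquiv {n : ℕ} (P Q : Set (Fin n → ℝ)) : Prop :=
  ∃ (k : ℕ) (c : Fin (k + 1) → Set (Fin n → ℝ)),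
    (∀ i, IsSmoothFano (c i)) ∧
    UnimodularEquiv P (c 0) ∧ UnimodularEquiv Q (c (Fin.last k)) ∧
    ∀ i : Fin k, IStep (c i.castSucc) (c i.succ)

/-- `Q` is the stellar subdivision of `P` at the new vertex `w`: `w` is the sum
of the vertices of a proper face `F` of `P`, and the facets of `Q` containing
`w` are exactly the sets `conv({w} ∪ (V(F') \ {v}))` for `F'` a facet of `P`
containing `F` and `v` a vertex of `F`. -/
def IsStellarSubdivisionAt {n : ℕ} (P Q : Set (Fin n → ℝ)) (w : Fin n → ℝ) : Prop :=
  ∃ F : Set (Fin n → ℝ), IsFaceOf F P ∧ F.Nonempty ∧ F ≠ P ∧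
    w = ∑ᶠ v ∈ vertexSet P ∩ F, v ∧
    {G : Set (Fin n → ℝ) | IsFacetOf G Q ∧ w ∈ G} =
      {G : Set (Fin n → ℝ) | ∃ F' v, IsFacetOf F' P ∧ F ⊆ F' ∧
        v ∈ vertexSet P ∩ F ∧
        G = convexHull ℝ (insert w ((vertexSet P ∩ F') \ {v}))}

/-- One step of an F-sequence: an I-step which moreover is a stellar
subdivision (or its inverse). -/
def FStep {n : ℕ} (P Q : Set (Fin n → ℝ)) : Prop :=
  (∃ w : Fin n → ℝ, IsLatticePoint w ∧ w ∉ vertexSet P ∧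
    vertexSet Q = vertexSet P ∪ {w} ∧ IsStellarSubdivisionAt P Q w) ∨
  (∃ w : Fin n → ℝ, IsLatticePoint w ∧ w ∉ vertexSet Q ∧
    vertexSet P = vertexSet Q ∪ {w} ∧ IsStellarSubdivisionAt Q P w)

/-- F-equivalence of smooth Fano `n`-polytopes. -/
def FEquiv {n : ℕ} (P Q : Set (Fin n → ℝ)) : Prop :=
  ∃ (k : ℕ) (c : Fin (k + 1) → Set (Fin n → ℝ)),
    (∀ i, IsSmoothFano (c i)) ∧
    UnimodularEquiv P (c 0) ∧ UnimodularEquiv Q (c (Fin.last k)) ∧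
    ∀ i : Fin k, FStep (c i.castSucc) (c i.succ)

/-- A smooth Fano polytope is F-isolated if every smooth Fano polytope
F-equivalent to it is unimodularly equivalent to it. -/
def FIsolated {n : ℕ} (P : Set (Fin n → ℝ)) : Prop :=
  ∀ Q : Set (Fin n → ℝ), IsSmoothFano Q → FEquiv Q P → UnimodularEquiv Q P

/-- A smooth Fano polytope is I-isolated if every smooth Fano polytope
I-equivalent to it is unimodularly equivalent to it. -/
def IIsolated {n : ℕ} (P : Set (Fin n → ℝ)) : Prop :=
  ∀ Q : Set (Fin n → ℝ), IsSmoothFano Q → IEquiv Q P → UnimodularEquiv Q P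

/-- A primitive collection of a smooth Fano polytope `P`: a nonempty set `A` of
vertices such that `conv(A)` is not a face of `P` but `conv(A \ {x})` is a face
of `P` for every `x ∈ A`. -/
def IsPrimitiveCollection {n : ℕ} (P A : Set (Fin n → ℝ)) : Prop :=
  A.Nonempty ∧ A ⊆ vertexSet P ∧ ¬ IsFaceOf (convexHull ℝ A) P ∧
    ∀ x ∈ A, IsFaceOf (convexHull ℝ (A \ {x})) P

/-- The standard basis vector `e_i` of `ℝ^n`. -/
def stdBasis {n : ℕ} (i : Fin n) : Fin n → ℝ := fun q => if q = i then 1 else 0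

/-- The polytope `T^n = conv{e_1, …, e_n, -(e_1 + ⋯ + e_n)}`,
corresponding to projective `n`-space. -/
def Tpoly (n : ℕ) : Set (Fin n → ℝ) :=
  convexHull ℝ (Set.range (stdBasis (n := n)) ∪ {fun _ => (-1 : ℝ)})

namespace Pab

/-! The concrete polytope `P(a,b)` of dimension `n = a + 2b - 1`, from the
proof of Theorem `pic3cha` (coordinates are `0`-based: the paper's `e_q` is
the standard basis vector at index `q - 1`). -/

/-- `v_i = e_i` for `1 ≤ i ≤ a-1`, and
`v_a = -e_1 - ⋯ - e_{a+2b-2} + (a+b-1) e_{a+2b-1}`. -/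
def v (a b : ℕ) (i : Fin a) : Fin (a + 2 * b - 1) → ℝ :=
  if i.val < a - 1 then fun q => if q.val = i.val then 1 else 0
  else fun q => if q.val = a + 2 * b - 2 then ((a + b - 1 : ℕ) : ℝ) else -1

/-- `y_j = e_{a-1+j}` for `1 ≤ j ≤ b-1`, and `y_b = e_{a+b-1} + ⋯ + e_{a+2b-2}`. -/
def y (a b : ℕ) (j : Fin b) : Fin (a + 2 * b - 1) → ℝ :=
  if j.val < b - 1 then fun q => if q.val = a - 1 + j.val then 1 else 0
  else fun q => if a + b - 2 ≤ q.val ∧ q.val ≤ a + 2 * b - 3 then 1 else 0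

/-- `z = -e_{a+2b-1}`. -/
def z (a b : ℕ) : Fin (a + 2 * b - 1) → ℝ :=
  fun q => if q.val = a + 2 * b - 2 then -1 else 0

/-- `t = e_{a+2b-1}`. -/
def t (a b : ℕ) : Fin (a + 2 * b - 1) → ℝ :=
  fun q => if q.val = a + 2 * b - 2 then 1 else 0

/-- `u_j = e_{a+b-1+j}` for `1 ≤ j ≤ b-1`, and
`u_b = e_a + ⋯ + e_{a+b-1} - e_{a+2b-1}`. -/
def u (a b : ℕ) (j : Fin b) : Fin (a + 2 * b - 1) → ℝ :=
  if j.val < b - 1 then fun q => if q.val = a + b - 1 + j.val then 1 else 0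
  else fun q => if a - 1 ≤ q.val ∧ q.val ≤ a + b - 2 then 1
    else if q.val = a + 2 * b - 2 then -1 else 0

/-- The polytope `P(a,b)`. -/
def P (a b : ℕ) : Set (Fin (a + 2 * b - 1) → ℝ) :=
  convexHull ℝ
    (Set.range (v a b) ∪ Set.range (y a b) ∪ {z a b, t a b} ∪ Set.range (u a b))

end Pab

lemma IsSmoothFano.isCompact {n : ℕ} {Q : Set (Fin n → ℝ)} (hQ : IsSmoothFano Q) :
    IsCompact Q := by
  obtain ⟨⟨⟨S, -, rfl⟩, -⟩, -⟩ := hQ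
  exact S.finite_toSet.isCompact_convexHull (𝕜 := ℝ)

lemma IsSmoothFano.convex {n : ℕ} {Q : Set (Fin n → ℝ)} (hQ : IsSmoothFano Q) :
    Convex ℝ Q := by
  obtain ⟨⟨⟨S, -, rfl⟩, -⟩, -⟩ := hQ
  exact convex_convexHull ℝ _

/-- A linear inequality valid on the vertices is valid on the whole polytope. -/
lemma IsSmoothFano.le_of_forall_vertexSet {n : ℕ} {Q : Set (Fin n → ℝ)} (hQ : IsSmoothFano Q)
    (φ : (Fin n → ℝ) →ₗ[ℝ] ℝ) (c : ℝ) (h : ∀ x ∈ vertexSet Q, φ x ≤ c) :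
    ∀ x ∈ Q, φ x ≤ c := by
  have hclosed : IsClosed {x | φ x ≤ c} :=
    isClosed_le φ.continuous_of_finiteDimensional continuous_const
  have hconv : Convex ℝ {x | φ x ≤ c} := convex_halfSpace_le φ.isLinear c
  intro x hx
  rw [← closure_convexHull_extremePoints hQ.isCompact hQ.convex] at hx
  exact closure_minimal (convexHull_min h hconv) hclosed hx

/-- A linear functional which is nonpositive on all vertices vanishes. -/
lemma IsSmoothFano.eq_zero_of_nonpos {n : ℕ} {Q : Set (Fin n → ℝ)} (hQ : IsSmoothFano Q)
    (φ : (Fin n → ℝ) →ₗ[ℝ] ℝ) (h : ∀ x ∈ vertexSet Q, φ x ≤ 0) : φ = 0 := by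
  have hle := hQ.le_of_forall_vertexSet φ 0 h
  have h0 : Q ∈ nhds (0 : Fin n → ℝ) := mem_interior_iff_mem_nhds.mp hQ.2.1
  have key : ∀ x, φ x ≤ 0 := by
    intro x
    have hc : Filter.Tendsto (fun r : ℝ => r • x) (nhdsWithin 0 (Set.Ioi 0)) (nhds 0) := by
      have : Continuous (fun r : ℝ => r • x) := by fun_prop
      simpa using (this.tendsto 0).mono_left nhdsWithin_le_nhds
    obtain ⟨r, hr, hr0⟩ := ((hc.eventually h0).and self_mem_nhdsWithin).exists
    have := hle _ hr
    rw [map_smul, smul_eq_mul] at this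
    exact nonpos_of_mul_nonpos_right this hr0
  ext1 x
  ext
  refine le_antisymm (key _) ?_
  have := key (-(LinearMap.single ℝ (fun _ => ℝ) x 1))
  rw [map_neg] at this
  simpa using this

lemma apply_eq_sum_single {n : ℕ} (φ : (Fin n → ℝ) →ₗ[ℝ] ℝ) (x : Fin n → ℝ) :
    φ x = ∑ q, x q * φ (Pi.single q 1) := by
  conv_lhs => rw [← Finset.univ_sum_single x, map_sum]
  refine Finset.sum_congr rfl fun q _ => ?_
  rw [← smul_eq_mul, ← map_smul, ← Pi.single_smul, smul_eq_mul, mul_one]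

/-- If a functional takes the value `1` on a unimodular basis, it is integral on `ℤ^n`. -/
lemma IsUnimodularBasis.exists_int_apply_single {n : ℕ} {S : Set (Fin n → ℝ)}
    (hS : IsUnimodularBasis S) (φ : (Fin n → ℝ) →ₗ[ℝ] ℝ) (h : ∀ x ∈ S, φ x = 1) (q : Fin n) :
    ∃ m : ℤ, φ (Pi.single q 1) = m := by
  obtain ⟨b, -, rfl, hlat, hdet⟩ := hS
  choose M hM using hlat
  have hB : Matrix.of b = (Matrix.of M).map (Int.castRingHom ℝ) := by
    ext i j
    simp [hM]
  have hdetM : IsUnit (Matrix.of M).det := by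
    rw [Int.isUnit_iff_abs_eq]
    rw [hB, ← RingHom.mapMatrix_apply, ← RingHom.map_det] at hdet
    rw [eq_intCast, ← Int.cast_abs] at hdet
    exact_mod_cast hdet
  have hinv : (Matrix.of M)⁻¹.map (Int.castRingHom ℝ) * Matrix.of b = 1 := by
    rw [hB, ← Matrix.map_mul, Matrix.nonsing_inv_mul _ hdetM]
    simp
  have hw : (Matrix.of b).mulVec (fun q => φ (Pi.single q 1)) = fun _ => 1 := by
    ext i
    have := h (b i) ⟨i, rfl⟩
    rw [apply_eq_sum_single] at this
    simpa [Matrix.mulVec, dotProduct] using this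
  refine ⟨∑ i, (Matrix.of M)⁻¹ q i, ?_⟩
  have := congrArg (((Matrix.of M)⁻¹.map (Int.castRingHom ℝ)).mulVec) hw
  rw [Matrix.mulVec_mulVec, hinv, Matrix.one_mulVec] at this
  have := congrFun this q
  simpa [Matrix.mulVec, dotProduct] using this

/-- A supporting functional of a smooth Fano polytope, normalized to have maximum `1`, that
attains `1` on a spanning set of vertices is integral on `ℤ^n`. -/
lemma IsSmoothFano.exists_int_apply_single {n : ℕ} {Q : Set (Fin n → ℝ)} (hQ : IsSmoothFano Q)
    (φ : (Fin n → ℝ) →ₗ[ℝ] ℝ) (hle : ∀ x ∈ vertexSet Q, φ x ≤ 1)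
    (hspan : ∀ ψ : (Fin n → ℝ) →ₗ[ℝ] ℝ, (∀ x ∈ vertexSet Q, φ x = 1 → ψ x = 0) → ψ = 0)
    (q : Fin n) : ∃ m : ℤ, φ (Pi.single q 1) = m := by
  by_cases hφ : φ = 0
  · exact ⟨0, by simp [hφ]⟩
  obtain ⟨p, hpV, hp⟩ : ∃ p ∈ vertexSet Q, φ p = 1 := by
    by_contra! hno
    exact hφ (hspan φ fun x hx h1 => absurd h1 (hno x hx))
  have hpQ : p ∈ Q := extremePoints_subset hpV
  have hleQ := hQ.le_of_forall_vertexSet φ 1 hle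
  set F : Set (Fin n → ℝ) := {x ∈ Q | φ x = 1} with hF
  have hface : IsFaceOf F Q := by
    intro _
    refine ⟨LinearMap.toContinuousLinearMap φ, ?_⟩
    ext x
    simp only [hF, Set.mem_ofPred_eq, LinearMap.coe_toContinuousLinearMap']
    constructor
    · rintro ⟨hx, h1⟩
      exact ⟨hx, fun y hy => h1 ▸ hleQ y hy⟩
    · rintro ⟨hx, h1⟩
      exact ⟨hx, le_antisymm (hleQ x hx) (hp ▸ h1 p hpQ)⟩
  have hker : vectorSpan ℝ F ≤ LinearMap.ker φ := by
    rw [vectorSpan_def, Submodule.span_le]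
    rintro _ ⟨x, hx, y, hy, rfl⟩
    simp [hx.2, hy.2]
  have hlt : Module.finrank ℝ (vectorSpan ℝ F) < n := by
    have hne : LinearMap.ker φ ≠ ⊤ := by rwa [Ne, LinearMap.ker_eq_top]
    have h1 := Submodule.finrank_lt hne
    have h2 := Submodule.finrank_mono hker
    rw [Module.finrank_fin_fun] at h1
    omega
  have htop : vectorSpan ℝ F ⊔ Submodule.span ℝ {p} = ⊤ := by
    by_contra hne
    obtain ⟨ψ, hψ, hψ'⟩ := Submodule.exists_le_ker_of_lt_top _ (lt_top_iff_ne_top.mpr hne)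
    refine hψ (hspan ψ fun x hx h1 => ?_)
    have hxp : x = (x - p) + p := by abel
    rw [hxp]
    refine hψ' (Submodule.add_mem_sup ?_ (Submodule.mem_span_singleton_self p))
    exact vsub_mem_vectorSpan ℝ ⟨extremePoints_subset hx, h1⟩ ⟨hpQ, hp⟩
  have hge : n ≤ Module.finrank ℝ (vectorSpan ℝ F) + 1 := by
    have h1 := Submodule.finrank_add_le_finrank_add_finrank (vectorSpan ℝ F)
      (Submodule.span ℝ {p})
    rw [htop, finrank_top, Module.finrank_fin_fun] at h1
    have h2 := finrank_span_le_card (R := ℝ) ({p} : Set (Fin n → ℝ))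
    simp only [Set.toFinset_singleton, Finset.card_singleton] at h2
    omega
  exact (hQ.2.2 F ⟨hface, by omega⟩).exists_int_apply_single φ (fun x hx => hx.2.2) q

namespace Pab

/-- The points defining `P(a,b)` as one indexed family. -/
def gen (a b : ℕ) : Fin a ⊕ Fin b ⊕ Fin b ⊕ Bool → Fin (a + 2 * b - 1) → ℝ :=
  Sum.elim (v a b) (Sum.elim (y a b) (Sum.elim (u a b) (fun c => if c then t a b else z a b)))

/-- The index of `t` in the family `gen`. -/
abbrev tIdx (a b : ℕ) : Fin a ⊕ Fin b ⊕ Fin b ⊕ Bool := Sum.inr (Sum.inr (Sum.inr true))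

lemma vertexSet_subset_range_gen (a b : ℕ) : vertexSet (P a b) ⊆ Set.range (gen a b) := by
  refine extremePoints_convexHull_subset.trans ?_
  rintro x (((⟨i, rfl⟩ | ⟨i, rfl⟩) | hx) | ⟨i, rfl⟩)
  · exact ⟨Sum.inl i, rfl⟩
  · exact ⟨Sum.inr (Sum.inl i), rfl⟩
  · rcases hx with rfl | rfl
    · exact ⟨Sum.inr (Sum.inr (Sum.inr false)), rfl⟩
    · exact ⟨tIdx a b, rfl⟩
  · exact ⟨Sum.inr (Sum.inr (Sum.inl i)), rfl⟩

lemma v_apply (a b : ℕ) (i : Fin a) (q : Fin (a + 2 * b - 1)) :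
    v a b i q = if i.val < a - 1 then (if q.val = i.val then 1 else 0)
      else if q.val = a + 2 * b - 2 then ((a + b - 1 : ℕ) : ℝ) else -1 := by
  unfold v
  split_ifs <;> simp_all

lemma y_apply (a b : ℕ) (j : Fin b) (q : Fin (a + 2 * b - 1)) :
    y a b j q = if j.val < b - 1 then (if q.val = a - 1 + j.val then 1 else 0)
      else if a + b - 2 ≤ q.val ∧ q.val ≤ a + 2 * b - 3 then 1 else 0 := by
  unfold y
  split_ifs <;> simp_all

lemma u_apply (a b : ℕ) (j : Fin b) (q : Fin (a + 2 * b - 1)) :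
    u a b j q = if j.val < b - 1 then (if q.val = a + b - 1 + j.val then 1 else 0)
      else if a - 1 ≤ q.val ∧ q.val ≤ a + b - 2 then 1
      else if q.val = a + 2 * b - 2 then -1 else 0 := by
  unfold u
  split_ifs <;> simp_all

lemma exists_functional_v {a b : ℕ} (ha : 2 ≤ a) (hb : 2 ≤ b) (i : Fin a) :
    ∃ φ : (Fin (a + 2 * b - 1) → ℝ) →ₗ[ℝ] ℝ, φ (v a b i) = 1 ∧
      (∀ j, j ≠ i → φ (v a b j) ≤ 0) ∧ (∀ j, φ (y a b j) ≤ 0) ∧ (∀ j, φ (u a b j) ≤ 0) ∧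
      φ (z a b) ≤ 0 ∧ φ (t a b) ≤ 0 := by
  by_cases hi : i.val < a - 1
  · refine ⟨LinearMap.proj ⟨i, by omega⟩,
      ?_, ?_, ?_, ?_, ?_, ?_⟩
    all_goals
      intros
      simp only [v_apply, y_apply, u_apply, z, t, LinearMap.proj_apply]
      grind
  · refine ⟨-LinearMap.proj ⟨0, by omega⟩,
      ?_, ?_, ?_, ?_, ?_, ?_⟩
    all_goals
      intros
      simp only [v_apply, y_apply, u_apply, z, t, LinearMap.neg_apply, LinearMap.proj_apply]
      grind

lemma exists_functional_y {a b : ℕ} (ha : 2 ≤ a) (hb : 2 ≤ b) (i : Fin b) :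
    ∃ φ : (Fin (a + 2 * b - 1) → ℝ) →ₗ[ℝ] ℝ, φ (y a b i) = 1 ∧
      (∀ j, φ (v a b j) ≤ 0) ∧ (∀ j, j ≠ i → φ (y a b j) ≤ 0) ∧ (∀ j, φ (u a b j) ≤ 0) ∧
      φ (z a b) ≤ 0 ∧ φ (t a b) ≤ 0 := by
  by_cases hi : i.val < b - 1
  · refine ⟨LinearMap.proj ⟨a - 1 + i, by omega⟩ - LinearMap.proj ⟨a + b - 2, by omega⟩,
      ?_, ?_, ?_, ?_, ?_, ?_⟩
    all_goals
      intros
      simp only [v_apply, y_apply, u_apply, z, t, LinearMap.sub_apply, LinearMap.proj_apply]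
      grind
  · refine ⟨LinearMap.proj ⟨a + b - 2, by omega⟩ - LinearMap.proj ⟨a - 1, by omega⟩,
      ?_, ?_, ?_, ?_, ?_, ?_⟩
    all_goals
      intros
      simp only [v_apply, y_apply, u_apply, z, t, LinearMap.sub_apply, LinearMap.proj_apply]
      grind

lemma exists_functional_u {a b : ℕ} (ha : 2 ≤ a) (hb : 2 ≤ b) (i : Fin b) :
    ∃ φ : (Fin (a + 2 * b - 1) → ℝ) →ₗ[ℝ] ℝ, φ (u a b i) = 1 ∧
      (∀ j, φ (v a b j) ≤ 0) ∧ (∀ j, φ (y a b j) ≤ 0) ∧ (∀ j, j ≠ i → φ (u a b j) ≤ 0) ∧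
      φ (z a b) ≤ 0 ∧ φ (t a b) ≤ 0 := by
  by_cases hi : i.val < b - 1
  · refine ⟨LinearMap.proj ⟨a + b - 1 + i, by omega⟩ - LinearMap.proj ⟨a + b - 2, by omega⟩,
      ?_, ?_, ?_, ?_, ?_, ?_⟩
    all_goals
      intros
      simp only [v_apply, y_apply, u_apply, z, t, LinearMap.sub_apply, LinearMap.proj_apply]
      grind
  · refine ⟨LinearMap.proj ⟨a + b - 2, by omega⟩ - LinearMap.proj ⟨a + b - 1, by omega⟩,
      ?_, ?_, ?_, ?_, ?_, ?_⟩
    all_goals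
      intros
      simp only [v_apply, y_apply, u_apply, z, t, LinearMap.sub_apply, LinearMap.proj_apply]
      grind

lemma exists_functional_z {a b : ℕ} (ha : 2 ≤ a) (hb : 2 ≤ b) :
    ∃ φ : (Fin (a + 2 * b - 1) → ℝ) →ₗ[ℝ] ℝ, φ (z a b) = 1 ∧
      (∀ j, φ (v a b j) ≤ 0) ∧ (∀ j, φ (y a b j) ≤ 0) ∧ (∀ j, φ (u a b j) ≤ 0) ∧
      φ (t a b) ≤ 0 := by
  have hc : (1 : ℝ) ≤ ((a + b - 1 : ℕ) : ℝ) := by exact_mod_cast (by omega : 1 ≤ a + b - 1)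
  refine ⟨-LinearMap.proj ⟨a + 2 * b - 2, by omega⟩ - LinearMap.proj ⟨a + b - 2, by omega⟩, ?_, ?_, ?_, ?_, ?_⟩
  all_goals
    intros
    simp only [v_apply, y_apply, u_apply, z, t, LinearMap.sub_apply, LinearMap.neg_apply,
      LinearMap.proj_apply]
    grind

/-- Every point of the family except `t` is strictly separated from all the others by a linear
hyperplane. -/
lemma exists_functional_gen {a b : ℕ} (ha : 2 ≤ a) (hb : 2 ≤ b)
    (k : Fin a ⊕ Fin b ⊕ Fin b ⊕ Bool) (hk : k ≠ tIdx a b) :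
    ∃ φ : (Fin (a + 2 * b - 1) → ℝ) →ₗ[ℝ] ℝ, φ (gen a b k) = 1 ∧
      ∀ l, l ≠ k → φ (gen a b l) ≤ 0 := by
  rcases k with i | i | i | c
  · obtain ⟨φ, h0, h1, h2, h3, h4, h5⟩ := exists_functional_v ha hb i
    refine ⟨φ, h0, ?_⟩
    rintro (j | j | j | _ | _) hj
    exacts [h1 j (by simpa using hj), h2 j, h3 j, h4, h5]
  · obtain ⟨φ, h0, h1, h2, h3, h4, h5⟩ := exists_functional_y ha hb i
    refine ⟨φ, h0, ?_⟩
    rintro (j | j | j | _ | _) hj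
    exacts [h1 j, h2 j (by simpa using hj), h3 j, h4, h5]
  · obtain ⟨φ, h0, h1, h2, h3, h4, h5⟩ := exists_functional_u ha hb i
    refine ⟨φ, h0, ?_⟩
    rintro (j | j | j | _ | _) hj
    exacts [h1 j, h2 j, h3 j (by simpa using hj), h4, h5]
  · cases c
    · obtain ⟨φ, h0, h1, h2, h3, h4⟩ := exists_functional_z ha hb
      refine ⟨φ, h0, ?_⟩
      rintro (j | j | j | _ | _) hj
      exacts [h1 j, h2 j, h3 j, absurd rfl hj, h4]
    · exact absurd rfl hk

lemma gen_injective {a b : ℕ} (ha : 2 ≤ a) (hb : 2 ≤ b) : Function.Injective (gen a b) := by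
  intro k l hkl
  by_contra hne
  by_cases hk : k = tIdx a b
  · obtain ⟨φ, h1, h2⟩ := exists_functional_gen ha hb l (by rintro rfl; exact hne hk)
    have := h2 k hne
    rw [hkl, h1] at this
    norm_num at this
  · obtain ⟨φ, h1, h2⟩ := exists_functional_gen ha hb k hk
    have := h2 l (Ne.symm hne)
    rw [← hkl, h1] at this
    norm_num at this

lemma sum_ite_val_eq {n k : ℕ} (hk : k < n) (c : ℝ) :
    ∑ q : Fin n, (if q.val = k then c else 0) = c := by
  rw [Finset.sum_eq_single ⟨k, hk⟩]
  · simp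
  · intro q _ hq
    exact if_neg fun h => hq (Fin.ext h)
  · simp

lemma sum_ite_val_mem_Icc {n l k : ℕ} (hk : k < n) :
    ∑ q : Fin n, (if l ≤ q.val ∧ q.val ≤ k then (1 : ℝ) else 0) = ((k + 1 - l : ℕ) : ℝ) := by
  rw [Fin.sum_univ_eq_sum_range (fun q => if l ≤ q ∧ q ≤ k then (1 : ℝ) else 0) n,
    Finset.sum_boole, ← Nat.card_Icc]
  congr 2
  ext q
  simp only [Finset.mem_filter, Finset.mem_range, Finset.mem_Icc]
  omega

lemma sum_v {a b : ℕ} (hb : 2 ≤ b) (i : Fin a) :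
    ∑ q, v a b i q = if i.val < a - 1 then 1 else 1 - (b : ℝ) := by
  simp only [v_apply]
  split_ifs with h
  · exact sum_ite_val_eq (by omega) 1
  · have hsplit : ∀ q : Fin (a + 2 * b - 1),
        (if q.val = a + 2 * b - 2 then ((a + b - 1 : ℕ) : ℝ) else -1) =
          (if q.val = a + 2 * b - 2 then ((a + b - 1 : ℕ) : ℝ) + 1 else 0) + -1 := by
      intro q
      split_ifs <;> ring
    rw [Finset.sum_congr rfl fun q _ => hsplit q, Finset.sum_add_distrib,
      sum_ite_val_eq (by omega)]
    simp only [Finset.sum_const, Finset.card_univ, Fintype.card_fin, nsmul_eq_mul]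
    rw [Nat.cast_sub (by omega), Nat.cast_sub (by omega)]
    push_cast
    ring

lemma sum_y {a b : ℕ} (ha : 2 ≤ a) (hb : 2 ≤ b) (j : Fin b) :
    ∑ q, y a b j q = if j.val < b - 1 then 1 else (b : ℝ) := by
  simp only [y_apply]
  split_ifs with h
  · exact sum_ite_val_eq (by omega) 1
  · rw [sum_ite_val_mem_Icc (by omega)]
    congr 1
    omega

lemma sum_u {a b : ℕ} (ha : 2 ≤ a) (hb : 2 ≤ b) (j : Fin b) :
    ∑ q, u a b j q = if j.val < b - 1 then 1 else (b : ℝ) - 1 := by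
  simp only [u_apply]
  split_ifs with h
  · exact sum_ite_val_eq (by omega) 1
  · have hsplit : ∀ q : Fin (a + 2 * b - 1),
        (if a - 1 ≤ q.val ∧ q.val ≤ a + b - 2 then (1 : ℝ)
          else if q.val = a + 2 * b - 2 then -1 else 0) =
        (if a - 1 ≤ q.val ∧ q.val ≤ a + b - 2 then 1 else 0) +
          if q.val = a + 2 * b - 2 then -1 else 0 := by
      intro q
      split_ifs <;> first | omega | simp
    rw [Finset.sum_congr rfl fun q _ => hsplit q, Finset.sum_add_distrib,
      sum_ite_val_eq (by omega), sum_ite_val_mem_Icc (by omega)]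
    have : a + b - 2 + 1 - (a - 1) = b := by omega
    rw [this]
    ring

/-- The points of the family other than `t` span a polytope with a facet whose supporting
functional is not integral. -/
lemma exists_nonintegral_functional {a b : ℕ} (ha : 2 ≤ a) (hb : 2 ≤ b) :
    ∃ φ : (Fin (a + 2 * b - 1) → ℝ) →ₗ[ℝ] ℝ,
      (∀ j, φ (v a b j) = 1) ∧ (∀ j, φ (y a b j) = 1) ∧
      (∀ j : Fin b, j.val < b - 1 → φ (u a b j) = 1) ∧ (∀ j, φ (u a b j) ≤ 1) ∧
      φ (z a b) ≤ 1 ∧ ∃ q, ∀ m : ℤ, φ (Pi.single q 1) ≠ m := by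
  have hN : 3 ≤ a + b - 1 := by omega
  have hN' : (3 : ℝ) ≤ ((a + b - 1 : ℕ) : ℝ) := by exact_mod_cast hN
  obtain ⟨N, hNdef⟩ : ∃ N : ℝ, N = ((a + b - 1 : ℕ) : ℝ) := ⟨_, rfl⟩
  rw [← hNdef] at hN'
  have hNinv : 0 < N⁻¹ := by positivity
  have hNmul : N⁻¹ * N = 1 := inv_mul_cancel₀ (by positivity)
  obtain ⟨φ, hφ⟩ : ∃ φ : (Fin (a + 2 * b - 1) → ℝ) →ₗ[ℝ] ℝ, ∀ x,
      φ x = ∑ q, x q + (1 - (b : ℝ)) * x ⟨a + b - 2, by omega⟩ +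
        N⁻¹ * x ⟨a + 2 * b - 2, by omega⟩ :=
    ⟨∑ q, LinearMap.proj q + (1 - (b : ℝ)) • LinearMap.proj ⟨a + b - 2, by omega⟩ +
      N⁻¹ • LinearMap.proj ⟨a + 2 * b - 2, by omega⟩, fun x => by simp⟩
  refine ⟨φ, ?_, ?_, ?_, ?_, ?_, ⟨a + 2 * b - 2, by omega⟩, ?_⟩
  · intro j
    rw [hφ, sum_v hb]
    simp only [v_apply, ← hNdef]
    grind
  · intro j
    rw [hφ, sum_y ha hb]
    simp only [y_apply]
    grind
  · intro j hj
    rw [hφ, sum_u ha hb]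
    simp only [u_apply]
    grind
  · intro j
    rw [hφ, sum_u ha hb]
    simp only [u_apply]
    split_ifs <;> first | omega | linarith
  · rw [hφ]
    simp only [z]
    rw [sum_ite_val_eq (by omega)]
    split_ifs <;> first | omega | linarith
  · intro m hm
    have hval : φ (Pi.single ⟨a + 2 * b - 2, by omega⟩ 1) = 1 + N⁻¹ := by
      rw [hφ, Finset.sum_pi_single']
      simp [Pi.single_apply]
      omega
    rw [hval] at hm
    have h1 : N⁻¹ < 1 := by nlinarith
    have h2 : (1 : ℝ) < m := by linarith
    have h3 : (m : ℝ) < 2 := by linarith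
    norm_cast at h2 h3
    omega

lemma eq_zero_of_apply_eq_zero {a b : ℕ} (ha : 2 ≤ a) (hb : 2 ≤ b)
    (ψ : (Fin (a + 2 * b - 1) → ℝ) →ₗ[ℝ] ℝ)
    (hv : ∀ j, ψ (v a b j) = 0) (hy : ∀ j, ψ (y a b j) = 0)
    (hu : ∀ j : Fin b, j.val < b - 1 → ψ (u a b j) = 0) : ψ = 0 := by
  have hne : ∀ q : Fin (a + 2 * b - 1), q.val ≠ a + b - 2 → q.val ≠ a + 2 * b - 2 →
      ψ (Pi.single q 1) = 0 := by
    intro q h1 h2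
    rcases lt_or_ge q.val (a - 1) with h | h
    · rw [← hv ⟨q, by omega⟩]
      congr 1
      ext r
      rw [v_apply, Pi.single_apply]
      grind
    · rcases lt_or_ge q.val (a + b - 2) with h' | h'
      · rw [← hy ⟨q - (a - 1), by omega⟩]
        congr 1
        ext r
        rw [y_apply, Pi.single_apply]
        grind
      · rw [← hu ⟨q - (a + b - 1), by omega⟩ (by simp only; omega)]
        congr 1
        ext r
        rw [u_apply, Pi.single_apply]
        grind
  have hp : ψ (Pi.single ⟨a + b - 2, by omega⟩ 1) = 0 := by
    have h := hy ⟨b - 1, by omega⟩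
    rw [apply_eq_sum_single, Finset.sum_eq_single ⟨a + b - 2, by omega⟩] at h
    · rw [y_apply] at h
      grind
    · intro q _ hq
      by_cases hm : q.val = a + 2 * b - 2
      · rw [y_apply]
        grind
      · rw [hne q (fun h => hq (Fin.ext h)) hm, mul_zero]
    · simp
  have hm : ψ (Pi.single ⟨a + 2 * b - 2, by omega⟩ 1) = 0 := by
    have h := hv ⟨a - 1, by omega⟩
    rw [apply_eq_sum_single, Finset.sum_eq_single ⟨a + 2 * b - 2, by omega⟩] at h
    · have hN : ((a + b - 1 : ℕ) : ℝ) ≠ 0 := by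
        exact_mod_cast (by omega : a + b - 1 ≠ 0)
      rw [v_apply] at h
      grind
    · intro q _ hq
      by_cases hqp : q.val = a + b - 2
      · have : q = ⟨a + b - 2, by omega⟩ := Fin.ext hqp
        rw [this, hp, mul_zero]
      · rw [hne q hqp (fun h => hq (Fin.ext h)), mul_zero]
    · simp
  refine LinearMap.ext fun x => ?_
  rw [apply_eq_sum_single, LinearMap.zero_apply]
  refine Finset.sum_eq_zero fun q _ => ?_
  by_cases h1 : q.val = a + b - 2
  · rw [show q = ⟨a + b - 2, by omega⟩ from Fin.ext h1, hp, mul_zero]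
  · by_cases h2 : q.val = a + 2 * b - 2
    · rw [show q = ⟨a + 2 * b - 2, by omega⟩ from Fin.ext h2, hm, mul_zero]
    · rw [hne q h1 h2, mul_zero]

end Pab

/-- For `a, b ≥ 2` and `n = a + 2b - 1`, there is no smooth Fano
`n`-polytope `Q` with `n + 2` vertices such that `V(Q) ⊆ V(P(a,b))`. -/
theorem no_smooth_Fano_subpolytope_of_Pab (a b : ℕ) (ha : 2 ≤ a) (hb : 2 ≤ b) :
    ¬ ∃ Q : Set (Fin (a + 2 * b - 1) → ℝ), IsSmoothFano Q ∧
      (vertexSet Q).ncard = (a + 2 * b - 1) + 2 ∧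
      vertexSet Q ⊆ vertexSet (Pab.P a b) := by
  rintro ⟨Q, hQ, hcard, hsub⟩
  have hrange : vertexSet Q ⊆ Set.range (Pab.gen a b) :=
    hsub.trans (Pab.vertexSet_subset_range_gen a b)
  have hι : Fintype.card (Fin a ⊕ Fin b ⊕ Fin b ⊕ Bool) = a + 2 * b + 2 := by
    simp
    omega
  obtain ⟨k, hk⟩ : ∃ k, Pab.gen a b k ∉ vertexSet Q := by
    by_contra! hall
    have heq : vertexSet Q = Set.range (Pab.gen a b) :=
      hrange.antisymm (by rintro _ ⟨k, rfl⟩; exact hall k)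
    rw [heq, ← Set.image_univ, Set.ncard_image_of_injective _ (Pab.gen_injective ha hb),
      Set.ncard_univ, Nat.card_eq_fintype_card, hι] at hcard
    omega
  have hlt : k = Pab.tIdx a b := by
    by_contra hkt
    obtain ⟨φ, h1, h2⟩ := Pab.exists_functional_gen ha hb k hkt
    have h0 : φ = 0 := hQ.eq_zero_of_nonpos φ fun x hx => by
      obtain ⟨l, rfl⟩ := hrange hx
      exact h2 l (by rintro rfl; exact hk hx)
    simp [h0] at h1
  subst hlt
  have hmem : ∀ l, l ≠ Pab.tIdx a b → Pab.gen a b l ∈ vertexSet Q := by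
    intro l hl
    by_contra hl'
    have hsub' : vertexSet Q ⊆
        Pab.gen a b '' (({l, Pab.tIdx a b} : Finset _)ᶜ : Finset _) := by
      intro x hx
      obtain ⟨m, rfl⟩ := hrange hx
      refine ⟨m, ?_, rfl⟩
      simp only [Finset.coe_compl, Finset.coe_insert, Finset.coe_singleton, Set.mem_compl_iff,
        Set.mem_insert_iff, Set.mem_singleton_iff, not_or]
      exact ⟨by rintro rfl; exact hl' hx, by rintro rfl; exact hk hx⟩
    have h1 := (Set.ncard_le_ncard hsub' ((Finset.finite_toSet _).image _)).trans
      (Set.ncard_image_le (Finset.finite_toSet _))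
    rw [Set.ncard_coe_finset, Finset.card_compl, Finset.card_pair hl, hι] at h1
    omega
  obtain ⟨φ, hv, hy, hu, hu', hz, q, hq⟩ := Pab.exists_nonintegral_functional ha hb
  obtain ⟨m, hm⟩ := hQ.exists_int_apply_single φ (by
    intro x hx
    obtain ⟨l, rfl⟩ := hrange hx
    rcases l with j | j | j | _ | _
    exacts [(hv j).le, (hy j).le, hu' j, hz, absurd hx hk]) (by
    intro ψ hψ
    refine Pab.eq_zero_of_apply_eq_zero ha hb ψ (fun j => ?_) (fun j => ?_) (fun j hj => ?_)
    · exact hψ _ (hmem (Sum.inl j) (by simp)) (hv j)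
    · exact hψ _ (hmem (Sum.inr (Sum.inl j)) (by simp)) (hy j)
    · exact hψ _ (hmem (Sum.inr (Sum.inr (Sum.inl j))) (by simp)) (hu j hj)) q
  exact hq m hm
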